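/- There exists a family of A^e-module homomorphisms ψ_m : A^{⊗(m+2)} → A^e ⊗ ∧^m(V) (m ≥ 0) with ψ_0 = id on A^e, forming a chain map from the bar resolution to the Koszul complex (i.e. ψ_{m−1} ∘ δ_m = d_m ∘ ψ_m for all m ≥ 1) and satisfying ψ_m ∘ φ_m = id on A^e ⊗ ∧^m(V) for all m ≥ 0. -/

import Mathlib

set_option synthInstance.maxHeartbeats 1000000
set_option maxHeartbeats 1000000

noncomputable section

open scoped TensorProduct

section QSA
variable (k : Type) [Field k] (N : ℕ) (q : Fin N → Fin N → k)

/-- The commutation relations of the quantum symmetric algebra. -/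
inductive QRel : FreeAlgebra k (Fin N) → FreeAlgebra k (Fin N) → Prop
  | rel (i j : Fin N) : QRel (FreeAlgebra.ι k i * FreeAlgebra.ι k j)
      (q i j • (FreeAlgebra.ι k j * FreeAlgebra.ι k i))

/-- The quantum symmetric algebra `A = S_q(V)`. -/
abbrev QSA := RingQuot (QRel k N q)

/-- The generator `x_i` of `S_q(V)`. -/
def X (i : Fin N) : QSA k N q := RingQuot.mkAlgHom k (QRel k N q) (FreeAlgebra.ι k i)

/-- The product `x_{j_1} x_{j_2} ⋯ x_{j_m}` associated to a tuple `j : Fin m → Fin N`. -/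
def xprod (m : ℕ) (j : Fin m → Fin N) : QSA k N q := (List.ofFn fun t => X k N q (j t)).prod

/-- The enveloping algebra `A^e = A ⊗_k A^{op}`. -/
abbrev QSAe := QSA k N q ⊗[k] (QSA k N q)ᵐᵒᵖ

/-- The tower of tensor powers: `TP n` is `A^{⊗(n+1)}`, as a `k`-module. -/
def TP : ℕ → ModuleCat k
  | 0 => ModuleCat.of k (QSA k N q)
  | n + 1 => ModuleCat.of k (QSA k N q ⊗[k] TP n)

/-- An elementary tensor `v 0 ⊗ v 1 ⊗ ⋯ ⊗ v n` in `A^{⊗(n+1)}`. -/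
def tp : (n : ℕ) → (Fin (n + 1) → QSA k N q) → TP k N q n
  | 0, v => v 0
  | n + 1, v => show QSA k N q ⊗[k] TP k N q n from (v 0) ⊗ₜ[k] tp n (fun t => v t.succ)

/-- Left multiplication by an element of `A` on the first tensor factor of `A^{⊗(n+1)}`. -/
def lAct : (n : ℕ) → QSA k N q →ₗ[k] (TP k N q n →ₗ[k] TP k N q n)
  | 0 => LinearMap.mul k (QSA k N q)
  | n + 1 => (LinearMap.rTensorHom (TP k N q n)).comp (LinearMap.mul k (QSA k N q))

/-- Right multiplication by an element of `A` on the last tensor factor of `A^{⊗(n+1)}`. -/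
def rAct : (n : ℕ) → QSA k N q →ₗ[k] (TP k N q n →ₗ[k] TP k N q n)
  | 0 => (LinearMap.mul k (QSA k N q)).flip
  | n + 1 =>
    show QSA k N q →ₗ[k]
        (QSA k N q ⊗[k] TP k N q n →ₗ[k] QSA k N q ⊗[k] TP k N q n) from
      (LinearMap.lTensorHom (QSA k N q)).comp (rAct n)

/-- The outer `A^e = A ⊗ A^{op}`-action on `A^{⊗(n+1)}`: `a ⊗ b^{op}` acts by multiplying
by `a` on the left in the first factor and by `b` on the right in the last factor. -/
def outerAct (n : ℕ) : QSAe k N q →ₗ[k] (TP k N q n →ₗ[k] TP k N q n) :=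
  TensorProduct.lift
    (LinearMap.mk₂ k
      (fun a b => (lAct k N q n a).comp (rAct k N q n (MulOpposite.unop b)))
      (fun a a' b => by simp [map_add, LinearMap.add_comp])
      (fun c a b => by simp [map_smul, LinearMap.smul_comp])
      (fun a b b' => by simp [map_add, LinearMap.comp_add])
      (fun c a b => by simp [map_smul, LinearMap.comp_smul]))

end QSA

section Bar
variable (k : Type) [Field k] (N : ℕ) (q : Fin N → Fin N → k)

/-- Multiplication of the first two tensor factors: `A^{⊗(n+2)} → A^{⊗(n+1)}`. -/
def barMul₀ : (n : ℕ) → (TP k N q (n + 1) →ₗ[k] TP k N q n)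
  | 0 => LinearMap.mul' k (QSA k N q)
  | n + 1 =>
    show QSA k N q ⊗[k] (QSA k N q ⊗[k] TP k N q n) →ₗ[k] QSA k N q ⊗[k] TP k N q n from
      (LinearMap.rTensor (TP k N q n) (LinearMap.mul' k (QSA k N q))).comp
        (TensorProduct.assoc k (QSA k N q) (QSA k N q) (TP k N q n)).symm.toLinearMap

/-- Multiplication of the tensor factors in positions `i, i+1` of `A^{⊗(n+2)}`
(0-indexed; for `i > n` we set the map to be zero, which does not occur below). -/
def barFace : (n : ℕ) → (i : ℕ) → (TP k N q (n + 1) →ₗ[k] TP k N q n)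
  | n, 0 => barMul₀ k N q n
  | 0, _ + 1 => 0
  | n + 1, i + 1 =>
    show QSA k N q ⊗[k] TP k N q (n + 1) →ₗ[k] QSA k N q ⊗[k] TP k N q n from
      LinearMap.lTensor (QSA k N q) (barFace n i)

/-- The bar differential `δ_n : A^{⊗(n+2)} → A^{⊗(n+1)}`,
`δ_n(a_0 ⊗ ⋯ ⊗ a_{n+1}) = Σ_{i=0}^{n} (-1)^i a_0 ⊗ ⋯ ⊗ a_i a_{i+1} ⊗ ⋯ ⊗ a_{n+1}`. -/
def barD (n : ℕ) : TP k N q (n + 1) →ₗ[k] TP k N q n :=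
  ∑ i ∈ Finset.range (n + 1), ((-1 : ℤ) ^ i) • barFace k N q n i

end Bar

section Phi
variable (k : Type) [Field k] (N : ℕ) (q : Fin N → Fin N → k)

/-- `A` is a left `A^e`-module via left and right multiplication. -/
instance : Module (QSAe k N q) (QSA k N q) := TensorProduct.Algebra.module

/-- The `m`-th term `A^e ⊗ ∧^m(V)` of the Koszul complex, realised as the free
`A^e`-module on the set of `m`-element subsets of `{1,…,N}` (corresponding to the basis
`x_{j_1} ∧ ⋯ ∧ x_{j_m}`, `j_1 < ⋯ < j_m`, of `∧^m(V)`). -/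
abbrev KM (m : ℕ) := {S : Finset (Fin N) // S.card = m} →₀ QSAe k N q

/-- The increasing enumeration `j_1 < j_2 < ⋯ < j_m` of an `m`-element subset of `{1,…,N}`. -/
def jfun (m : ℕ) (S : {S : Finset (Fin N) // S.card = m}) : Fin m → Fin N :=
  fun t => S.1.orderIsoOfFin S.2 t

/-- The element `Σ_{π ∈ S_m} sgn(π) q_π^{j_1,…,j_m} ⊗ x_{j_{π(1)}} ⊗ ⋯ ⊗ x_{j_{π(m)}} ⊗ 1`
of `A^{⊗(m+2)}`, where `Qs` encodes the scalars `q_π^{j_1,…,j_m}`. -/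
def phiElt (Qs : (m : ℕ) → (Fin m → Fin N) → Equiv.Perm (Fin m) → k) (m : ℕ)
    (S : {S : Finset (Fin N) // S.card = m}) : TP k N q (m + 1) :=
  ∑ π : Equiv.Perm (Fin m),
    ((Equiv.Perm.sign π : ℤ) • Qs m (jfun N m S) π) •
      tp k N q (m + 1)
        (Fin.cons 1 (Fin.snoc (fun t : Fin m => X k N q (jfun N m S (π t))) 1))

/-- The chain map `φ_m : A^e ⊗ ∧^m(V) → A^{⊗(m+2)}` of the paper, determined by
`φ_m(1 ⊗ 1 ⊗ x_{j_1} ∧ ⋯ ∧ x_{j_m}) =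
  Σ_{π ∈ S_m} sgn(π) q_π^{j_1,…,j_m} ⊗ x_{j_{π(1)}} ⊗ ⋯ ⊗ x_{j_{π(m)}} ⊗ 1`
together with `A^e`-linearity (the outer two tensor factors carry the `A^e`-action). -/
def phi (Qs : (m : ℕ) → (Fin m → Fin N) → Equiv.Perm (Fin m) → k) (m : ℕ) :
    KM k N q m →ₗ[k] TP k N q (m + 1) :=
  Finsupp.lsum k fun S => (outerAct k N q (m + 1)).flip (phiElt k N q Qs m S)

/-- The Koszul differential `d_{m+1}`, as an `A^e`-linear map. -/
def kd (m : ℕ) : KM k N q (m + 1) →ₗ[QSAe k N q] KM k N q m :=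
  Finsupp.linearCombination (QSAe k N q)
    (fun S : {S : Finset (Fin N) // S.card = m + 1} =>
      ∑ i ∈ S.1.attach,
        ((-1 : k) ^ (S.1.filter (fun s => s < i.1)).card) •
          Finsupp.single
            (⟨S.1.erase i.1, by rw [Finset.card_erase_of_mem i.2, S.2]; rfl⟩ :
              {S : Finset (Fin N) // S.card = m})
            ((∏ s ∈ S.1.filter (fun s => s ≤ i.1), q s i.1) •
                (X k N q i.1 ⊗ₜ[k] (1 : (QSA k N q)ᵐᵒᵖ))
              - (∏ s ∈ S.1.filter (fun s => i.1 ≤ s), q i.1 s) •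
                ((1 : QSA k N q) ⊗ₜ[k] MulOpposite.op (X k N q i.1))))

/-- The Koszul differential, as a `k`-linear map. -/
def kdk (m : ℕ) : KM k N q (m + 1) →ₗ[k] KM k N q m :=
  LinearMap.restrictScalars k (kd k N q m)

end Phi


section Helpers
variable {k : Type} [Field k] {N : ℕ} {q : Fin N → Fin N → k}

variable (k N q) in
/-- word product -/
def wP (l : List (Fin N)) : QSA k N q := (l.map (X k N q)).prod

variable (q) in
/-- scalar -/
def chi (j : Fin N) (l : List (Fin N)) : k := (l.map (q j)).prod

variable (k N q) in
theorem X_comm (i j : Fin N) : X k N q i * X k N q j = q i j • (X k N q j * X k N q i) := by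
  have := RingQuot.mkAlgHom_rel k (QRel.rel (k := k) (q := q) i j)
  simpa [X, map_mul, map_smul] using this

theorem wP_nil : wP k N q [] = 1 := by simp [wP]

theorem wP_cons (j : Fin N) (l) : wP k N q (j :: l) = X k N q j * wP k N q l := by simp [wP]

theorem wP_append_singleton (j : Fin N) (l) :
    wP k N q (l ++ [j]) = wP k N q l * X k N q j := by simp [wP]

theorem chi_cons (j i : Fin N) (l) : chi q j (i :: l) = q j i * chi q j l := by simp [chi]

theorem chi_append_singleton (j i : Fin N) (l) : chi q j (l ++ [i]) = chi q j l * q j i := by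
  simp [chi]

theorem X_mul_wP (j : Fin N) (l) : X k N q j * wP k N q l = chi q j l • (wP k N q l * X k N q j) := by
  induction l with
  | nil => simp [wP, chi]
  | cons i l ih =>
    rw [wP_cons, chi_cons, ← mul_assoc, X_comm, smul_mul_assoc, mul_assoc, ih, mul_smul_comm,
      smul_smul, mul_assoc]

theorem chi_ne (hq0 : ∀ i j, q i j ≠ 0) (j : Fin N) (l) : chi q j l ≠ 0 := by
  induction l with
  | nil => simp [chi]
  | cons i l ih => rw [chi_cons]; exact mul_ne_zero (hq0 _ _) ih

theorem chi_perm (j : Fin N) {l l' : List (Fin N)} (h : l.Perm l') : chi q j l = chi q j l' :=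
  (h.map _).prod_eq

theorem wP_perm {l l' : List (Fin N)} (h : l.Perm l') :
    ∃ c : k, wP k N q l = c • wP k N q l' := by
  induction h with
  | nil => exact ⟨1, by simp⟩
  | cons x _ ih => obtain ⟨c, hc⟩ := ih; exact ⟨c, by rw [wP_cons, hc, wP_cons, mul_smul_comm]⟩
  | swap x y l =>
    exact ⟨q y x, by simp only [wP_cons, ← mul_assoc]; rw [X_comm k N q y x, smul_mul_assoc]⟩
  | trans _ _ ih1 ih2 =>
    obtain ⟨c, hc⟩ := ih1; obtain ⟨d, hd⟩ := ih2
    exact ⟨c * d, by rw [hc, hd, smul_smul]⟩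

theorem span_wP : Submodule.span k (Set.range (wP k N q)) = ⊤ := by
  rw [eq_top_iff]
  rintro a -
  obtain ⟨f, rfl⟩ := RingQuot.mkAlgHom_surjective k (QRel k N q) a
  induction f using FreeAlgebra.induction with
  | grade0 r =>
    rw [AlgHom.commutes, Algebra.algebraMap_eq_smul_one]
    exact Submodule.smul_mem _ _ (Submodule.subset_span ⟨[], wP_nil⟩)
  | grade1 i => exact Submodule.subset_span ⟨[i], by simp [wP, X]⟩
  | add a b ha hb => rw [map_add]; exact add_mem ha hb
  | mul a b ha hb =>
    rw [map_mul]
    have := Submodule.mul_mem_mul ha hb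
    rw [Submodule.span_mul_span] at this
    refine Submodule.span_mono ?_ this
    rintro _ ⟨_, ⟨l, rfl⟩, _, ⟨l', rfl⟩, rfl⟩
    exact ⟨l ++ l', by simp [wP]⟩

/-- sorted words span -/
theorem A_induct {p : QSA k N q → Prop} (h0 : p 0) (hadd : ∀ a b, p a → p b → p (a + b))
    (hs : ∀ (c : k) a, p a → p (c • a)) (hw : ∀ l : List (Fin N), l.Pairwise (· ≤ ·) → p (wP k N q l))
    (a : QSA k N q) : p a := by
  have ha : a ∈ Submodule.span k (Set.range (wP k N q)) := by rw [span_wP]; trivial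
  induction ha using Submodule.span_induction with
  | zero => exact h0
  | add _ _ _ _ h1 h2 => exact hadd _ _ h1 h2
  | smul c _ _ h1 => exact hs _ _ h1
  | mem x hx =>
    obtain ⟨l, rfl⟩ := hx
    obtain ⟨c, hc⟩ := wP_perm (k := k) (q := q) (List.mergeSort_perm l (· ≤ ·)).symm
    rw [hc]
    refine hs _ _ (hw _ ?_)
    have := List.pairwise_mergeSort (le := fun a b : Fin N => decide (a ≤ b)) (by simp; omega) (by simp; omega) l
    simpa using this

variable (q) in
/-- scalar for the representation -/
def cc (j : Fin N) (s : Multiset (Fin N)) : k := (s.map fun l => if l < j then q j l else 1).prod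

variable (q) in
/-- operator -/
def opX (j : Fin N) : (Multiset (Fin N) →₀ k) →ₗ[k] (Multiset (Fin N) →₀ k) :=
  Finsupp.lsum k fun s => cc q j s • Finsupp.lsingle (j ::ₘ s)

theorem opX_single (j : Fin N) (s) (c : k) :
    opX q j (Finsupp.single s c) = (c * cc q j s) • Finsupp.single (j ::ₘ s) 1 := by
  simp [opX, mul_comm]

theorem opX_comm (hq0 : ∀ i j, q i j ≠ 0) (hq1 : ∀ i, q i i = 1)
    (hqinv : ∀ i j, q j i = (q i j)⁻¹) (i j : Fin N) :
    opX q i * opX q j = q i j • (opX q j * opX q i) := by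
  refine Finsupp.lhom_ext fun s c => ?_
  simp only [Module.End.mul_apply, LinearMap.smul_apply, opX_single, map_smul, smul_smul,
    Multiset.cons_swap i j, one_mul]
  congr 1
  simp only [cc, Multiset.map_cons, Multiset.prod_cons]
  rcases lt_trichotomy i j with h | h | h
  · have h' : ¬ j < i := by omega
    simp only [h, h', if_true, if_false]
    have := hqinv i j
    have h2 := hq0 i j
    rw [this]; field_simp
  · subst h; simp [hq1]
  · have h' : ¬ i < j := by omega
    simp only [h, h', if_true, if_false]
    ring

/-- representation -/
def rep (hq0 : ∀ i j, q i j ≠ 0) (hq1 : ∀ i, q i i = 1)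
    (hqinv : ∀ i j, q j i = (q i j)⁻¹) : QSA k N q →ₐ[k] Module.End k (Multiset (Fin N) →₀ k) :=
  RingQuot.liftAlgHom k ⟨FreeAlgebra.lift k (opX q), by
    rintro _ _ ⟨i, j⟩
    simp only [map_mul, map_smul, FreeAlgebra.lift_ι_apply]
    exact opX_comm hq0 hq1 hqinv i j⟩

theorem rep_X (hq0 : ∀ i j, q i j ≠ 0) (hq1 : ∀ i, q i i = 1)
    (hqinv : ∀ i j, q j i = (q i j)⁻¹) (j) : rep hq0 hq1 hqinv (X k N q j) = opX q j := by
  simp [rep, X]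

/-- normal form -/
theorem exists_nf (hq0 : ∀ i j, q i j ≠ 0) (hq1 : ∀ i, q i i = 1)
    (hqinv : ∀ i j, q j i = (q i j)⁻¹) : ∃ nf : QSA k N q →ₗ[k] (Multiset (Fin N) →₀ k),
    ∀ l : List (Fin N), l.Pairwise (· ≤ ·) → nf (wP k N q l) = Finsupp.single (l : Multiset (Fin N)) 1 := by
  refine ⟨(LinearMap.applyₗ (Finsupp.single 0 1)).comp (rep hq0 hq1 hqinv).toLinearMap, ?_⟩
  intro l hl
  simp only [LinearMap.comp_apply, LinearMap.applyₗ_apply_apply, AlgHom.toLinearMap_apply]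
  induction l with
  | nil => simp [wP]
  | cons j l ih =>
    rw [List.pairwise_cons] at hl
    rw [wP_cons, map_mul, Module.End.mul_apply, ih hl.2, rep_X, opX_single, one_mul]
    have : cc q j (l : Multiset (Fin N)) = 1 := by
      apply Multiset.prod_eq_one
      intro x hx
      simp only [Multiset.map_coe, Multiset.mem_coe, List.mem_map] at hx
      obtain ⟨y, hy, rfl⟩ := hx
      rw [if_neg (not_lt.mpr (hl.1 y hy))]
    rw [this, one_smul]; rfl

end Helpers
section Helpers2
variable {k : Type} [Field k] {N : ℕ} {q : Fin N → Fin N → k}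

/-- left embedding -/
def lE (a : QSA k N q) : QSAe k N q := a ⊗ₜ[k] (1 : (QSA k N q)ᵐᵒᵖ)

/-- right embedding -/
def rE (b : QSA k N q) : QSAe k N q := (1 : QSA k N q) ⊗ₜ[k] MulOpposite.op b

theorem lE_one : lE (1 : QSA k N q) = 1 := rfl
theorem rE_one : rE (1 : QSA k N q) = 1 := rfl
theorem lE_zero : lE (0 : QSA k N q) = 0 := by simp [lE]
theorem lE_add (a b : QSA k N q) : lE (a + b) = lE a + lE b := by simp [lE, TensorProduct.add_tmul]
theorem lE_smul (c : k) (a : QSA k N q) : lE (c • a) = c • lE a := by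
  simp [lE, TensorProduct.smul_tmul']
theorem rE_zero : rE (0 : QSA k N q) = 0 := by simp [rE]
theorem rE_add (a b : QSA k N q) : rE (a + b) = rE a + rE b := by simp [rE, TensorProduct.tmul_add]
theorem rE_smul (c : k) (a : QSA k N q) : rE (c • a) = c • rE a := by
  simp [rE, TensorProduct.tmul_smul]
theorem lE_mul (a b : QSA k N q) : lE (a * b) = lE a * lE b := by
  simp [lE, Algebra.TensorProduct.tmul_mul_tmul]
theorem rE_mul (a b : QSA k N q) : rE (a * b) = rE b * rE a := by
  simp [rE, Algebra.TensorProduct.tmul_mul_tmul]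
theorem rE_lE (a b : QSA k N q) : rE b * lE a = lE a * rE b := by
  simp [lE, rE, Algebra.TensorProduct.tmul_mul_tmul]
theorem tmul_eq (a : QSA k N q) (b : (QSA k N q)ᵐᵒᵖ) : a ⊗ₜ[k] b = rE b.unop * lE a := by
  simp [lE, rE, Algebra.TensorProduct.tmul_mul_tmul]

variable (k N q) in
/-- the action of `A^e`, as a linear map -/
def actE (m : ℕ) (w : QSAe k N q) : KM k N q m →ₗ[k] KM k N q m :=
  Finsupp.mapRange.linearMap (LinearMap.mulLeft k w)

theorem actE_eq {m : ℕ} (w : QSAe k N q) (z : KM k N q m) : actE k N q m w z = w • z := by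
  ext S; rfl

theorem actE_single {m : ℕ} (w : QSAe k N q) (S) (v : QSAe k N q) :
    actE k N q m w (Finsupp.single S v) = Finsupp.single S (w * v) := by
  simp [actE]

theorem actE_mul {m : ℕ} (w w' : QSAe k N q) (z : KM k N q m) :
    actE k N q m (w * w') z = actE k N q m w (actE k N q m w' z) := by
  ext S; simp [actE, mul_assoc]

theorem actE_one {m : ℕ} (z : KM k N q m) : actE k N q m 1 z = z := by
  ext S; simp [actE]

theorem actE_zero {m : ℕ} (z : KM k N q m) : actE k N q m 0 z = 0 := by
  ext S; simp [actE]

theorem actE_add {m : ℕ} (w w' : QSAe k N q) (z : KM k N q m) :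
    actE k N q m (w + w') z = actE k N q m w z + actE k N q m w' z := by
  ext S; simp [actE, add_mul]

theorem actE_smul {m : ℕ} (c : k) (w : QSAe k N q) (z : KM k N q m) :
    actE k N q m (c • w) z = c • actE k N q m w z := by
  ext S; simp only [actE, Finsupp.mapRange.linearMap_apply, Finsupp.mapRange_apply,
    Finsupp.smul_apply, LinearMap.mulLeft_apply]
  exact smul_mul_assoc c w (z S)

theorem kdk_actE {m : ℕ} (w : QSAe k N q) (z : KM k N q (m + 1)) :
    kdk k N q m (actE k N q (m + 1) w z) = actE k N q m w (kdk k N q m z) := by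
  rw [actE_eq, actE_eq]; exact map_smul (kd k N q m) w z

variable (k N q) in
/-- left multiplication -/
def lA (m : ℕ) (a : QSA k N q) : KM k N q m →ₗ[k] KM k N q m := actE k N q m (lE a)

variable (k N q) in
/-- right multiplication -/
def rA (m : ℕ) (a : QSA k N q) : KM k N q m →ₗ[k] KM k N q m := actE k N q m (rE a)

section
variable {m : ℕ} (a b : QSA k N q) (c : k) (z : KM k N q m)
theorem lA_one : lA k N q m 1 z = z := by rw [lA, lE_one, actE_one]
theorem rA_one : rA k N q m 1 z = z := by rw [rA, rE_one, actE_one]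
theorem lA_zero : lA k N q m 0 z = 0 := by rw [lA, lE_zero, actE_zero]
theorem lA_add : lA k N q m (a + b) z = lA k N q m a z + lA k N q m b z := by
  rw [lA, lE_add, actE_add]; rfl
theorem rA_add : rA k N q m (a + b) z = rA k N q m a z + rA k N q m b z := by
  rw [rA, rE_add, actE_add]; rfl
theorem lA_smul : lA k N q m (c • a) z = c • lA k N q m a z := by
  rw [lA, lE_smul, actE_smul]; rfl
theorem rA_smul : rA k N q m (c • a) z = c • rA k N q m a z := by
  rw [rA, rE_smul, actE_smul]; rfl
theorem lA_mul : lA k N q m (a * b) z = lA k N q m a (lA k N q m b z) := by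
  rw [lA, lE_mul, actE_mul]; rfl
theorem rA_mul : rA k N q m (a * b) z = rA k N q m b (rA k N q m a z) := by
  rw [rA, rE_mul, actE_mul]; rfl
theorem rA_lA : rA k N q m b (lA k N q m a z) = lA k N q m a (rA k N q m b z) := by
  rw [rA, lA, ← actE_mul, ← actE_mul, rE_lE]
theorem kdk_lA (z : KM k N q (m + 1)) :
    kdk k N q m (lA k N q (m + 1) a z) = lA k N q m a (kdk k N q m z) := kdk_actE _ _
theorem kdk_rA (z : KM k N q (m + 1)) :
    kdk k N q m (rA k N q (m + 1) a z) = rA k N q m a (kdk k N q m z) := kdk_actE _ _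
end

variable (k N q) in
/-- basis element -/
def eT (m : ℕ) (T : Finset (Fin N)) : KM k N q m :=
  if h : T.card = m then Finsupp.single ⟨T, h⟩ 1 else 0

theorem eT_pos {m : ℕ} {T : Finset (Fin N)} (h : T.card = m) :
    eT k N q m T = Finsupp.single ⟨T, h⟩ 1 := by simp [eT, h]

theorem kd_eT {m : ℕ} {T : Finset (Fin N)} (h : T.card = m + 1) :
    kdk k N q m (eT k N q (m + 1) T) = ∑ i ∈ T, ((-1 : k) ^ (T.filter (fun s => s < i)).card) •
      ((∏ s ∈ T.filter (fun s => s ≤ i), q s i) • (lA k N q m (X k N q i) (eT k N q m (T.erase i)))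
        + (- ∏ s ∈ T.filter (fun s => i ≤ s), q i s) •
          (rA k N q m (X k N q i) (eT k N q m (T.erase i)))) := by
  rw [eT_pos h, kdk, LinearMap.restrictScalars_apply, kd, Finsupp.linearCombination_single, one_smul]
  conv_rhs => rw [← Finset.sum_attach]
  refine Finset.sum_congr rfl fun i _ => ?_
  have hc : (T.erase i.1).card = m := by rw [Finset.card_erase_of_mem i.2, h]; rfl
  rw [eT_pos hc]
  rw [lA, rA, actE_single, actE_single, mul_one, mul_one, Finsupp.smul_single, Finsupp.smul_single,
    Finsupp.smul_single, ← Finsupp.single_add]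
  rw [Finsupp.smul_single]
  congr 2
  rw [sub_eq_add_neg]
  congr 1
  exact (neg_smul (M := QSAe k N q) (∏ s ∈ T with i.1 ≤ s, q i.1 s) (rE (X k N q i.1))).symm

/-- induction principle for `KM` -/
theorem KM_induct {m : ℕ} {p : KM k N q m → Prop} (h0 : p 0) (hadd : ∀ a b, p a → p b → p (a + b))
    (hs : ∀ (c : k) a, p a → p (c • a)) (hr : ∀ (b : QSA k N q) z, p z → p (rA k N q m b z))
    (hw : ∀ (l : List (Fin N)), l.Pairwise (· ≤ ·) → ∀ T : Finset (Fin N), T.card = m →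
      p (lA k N q m (wP k N q l) (eT k N q m T))) (z : KM k N q m) : p z := by
  induction z using Finsupp.induction_linear with
  | zero => exact h0
  | add f g hf hg => exact hadd _ _ hf hg
  | single S w =>
    induction w using TensorProduct.induction_on with
    | zero => simpa using h0
    | add x y hx hy => rw [Finsupp.single_add]; exact hadd _ _ hx hy
    | tmul a b =>
      have : Finsupp.single S (a ⊗ₜ[k] b) = rA k N q m b.unop (lA k N q m a (eT k N q m S.1)) := by
        rw [eT_pos S.2, tmul_eq, lA, rA, actE_single, actE_single, mul_one]
      rw [this]
      apply hr
      clear this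
      induction a using A_induct with
      | h0 => rw [lA_zero]; exact h0
      | hadd a b ha hb => rw [lA_add]; exact hadd _ _ ha hb
      | hs c a ha => rw [lA_smul]; exact hs _ _ ha
      | hw l hl => exact hw l hl S.1 S.2

variable (k N q) in
/-- homotopy on words -/
def HL (m : ℕ) (T : Finset (Fin N)) : List (Fin N) → KM k N q (m + 1)
  | [] => 0
  | j :: l => (chi q j l * ∏ s ∈ T, q j s) • (rA k N q (m + 1) (X k N q j) (HL m T l)) +
      if ∀ s ∈ T, j < s then chi q j l • (lA k N q (m + 1) (wP k N q l) (eT k N q (m + 1) (insert j T))) else 0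

/-- existence of the homotopy as a linear map -/
theorem exists_h (hq0 : ∀ i j, q i j ≠ 0) (hq1 : ∀ i, q i i = 1)
    (hqinv : ∀ i j, q j i = (q i j)⁻¹) (m : ℕ) :
    ∃ h : KM k N q m →ₗ[k] KM k N q (m + 1), (∀ (b : QSA k N q) z, h (rA k N q m b z) = rA k N q (m + 1) b (h z)) ∧
      ∀ l : List (Fin N), l.Pairwise (· ≤ ·) → ∀ T : Finset (Fin N), T.card = m →
        h (lA k N q m (wP k N q l) (eT k N q m T)) = HL k N q m T l := by
  obtain ⟨nf, hnf⟩ := exists_nf hq0 hq1 hqinv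
  let H (T : Finset (Fin N)) : QSA k N q →ₗ[k] KM k N q (m + 1) :=
    (Finsupp.linearCombination k fun s : Multiset (Fin N) => HL k N q m T (s.sort (· ≤ ·))).comp nf
  let B (T : Finset (Fin N)) : QSA k N q ⊗[k] (QSA k N q)ᵐᵒᵖ →ₗ[k] KM k N q (m + 1) :=
    TensorProduct.lift (LinearMap.mk₂ k (fun a b => rA k N q (m + 1) b.unop (H T a))
      (fun a a' b => by rw [map_add, map_add])
      (fun c a b => by rw [map_smul, map_smul])
      (fun a b b' => by rw [MulOpposite.unop_add, rA_add])
      (fun c a b => by rw [MulOpposite.unop_smul, rA_smul]))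
  let h : KM k N q m →ₗ[k] KM k N q (m + 1) := Finsupp.lsum k fun S => B S.1
  have hB (T a b) : B T (a ⊗ₜ[k] b) = rA k N q (m + 1) b.unop (H T a) := by simp [B]
  have hs (S w) : h (Finsupp.single S w) = B S.1 w := by simp [h]
  refine ⟨h, ?_, ?_⟩
  · intro b z
    induction z using Finsupp.induction_linear with
    | zero => simp
    | add f g hf hg => rw [map_add, map_add, map_add, hf, hg, map_add]
    | single S w =>
      rw [hs, rA, actE_single, hs]
      induction w using TensorProduct.induction_on with
      | zero => simp
      | add x y hx hy => rw [mul_add, map_add, map_add, hx, hy, map_add]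
      | tmul a c =>
        have : rE b * (a ⊗ₜ[k] c : QSAe k N q) = a ⊗ₜ[k] (MulOpposite.op b * c) := by
          simp [rE, Algebra.TensorProduct.tmul_mul_tmul]
        rw [this, hB, hB, MulOpposite.unop_mul, rA_mul]; rfl
  · intro l hl T hT
    rw [eT_pos hT, lA, actE_single, hs, mul_one, lE, hB]
    have : (l : Multiset (Fin N)).sort (· ≤ ·) = l := by
      rw [Multiset.coe_sort]
      exact List.mergeSort_of_pairwise (by simpa using hl)
    simp only [H, LinearMap.comp_apply, hnf l hl, Finsupp.linearCombination_single, one_smul, this]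
    rw [MulOpposite.unop_one, rA_one]

end Helpers2
section Helpers3
variable {k : Type} [Field k] {N : ℕ} {q : Fin N → Fin N → k}

/-- the properties of the homotopy -/
structure IsH (q : Fin N → Fin N → k) (h : ∀ m, KM k N q m →ₗ[k] KM k N q (m + 1)) : Prop where
  right : ∀ m (b : QSA k N q) z, h m (rA k N q m b z) = rA k N q (m + 1) b (h m z)
  word : ∀ m, ∀ l : List (Fin N), l.Pairwise (· ≤ ·) → ∀ T : Finset (Fin N), T.card = m →
        h m (lA k N q m (wP k N q l) (eT k N q m T)) = HL k N q m T l

theorem exists_sorted (l : List (Fin N)) : ∃ l', l.Perm l' ∧ l'.Pairwise (· ≤ ·) := by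
  refine ⟨_, (List.mergeSort_perm l (· ≤ ·)).symm, ?_⟩
  have := List.pairwise_mergeSort (le := fun a b : Fin N => decide (a ≤ b)) (by simp; omega) (by simp; omega) l
  simpa using this

variable {h : ∀ m, KM k N q m →ₗ[k] KM k N q (m + 1)}

theorem IsH.rule (hh : IsH q h) (m : ℕ) (T : Finset (Fin N)) (hT : T.card = m) (j : Fin N)
    (w : List (Fin N)) (hw : ∀ i ∈ w, j ≤ i) :
    h m (lA k N q m (wP k N q (j :: w)) (eT k N q m T)) =
      (chi q j w * ∏ s ∈ T, q j s) • rA k N q (m + 1) (X k N q j)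
          (h m (lA k N q m (wP k N q w) (eT k N q m T))) +
        if ∀ s ∈ T, j < s then
          chi q j w • (lA k N q (m + 1) (wP k N q w) (eT k N q (m + 1) (insert j T))) else 0 := by
  obtain ⟨l, hp, hl⟩ := exists_sorted w
  obtain ⟨c, hc⟩ := wP_perm (k := k) (q := q) hp
  have hjl : (j :: l).Pairwise (· ≤ ·) :=
    List.pairwise_cons.2 ⟨fun i hi => hw i (hp.mem_iff.2 hi), hl⟩
  have e1 : wP k N q (j :: w) = c • wP k N q (j :: l) := by
    rw [wP_cons, hc, wP_cons, mul_smul_comm]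
  rw [e1, hc, lA_smul, map_smul, hh.word m _ hjl T hT, HL, chi_perm j hp, lA_smul, map_smul,
    hh.word m _ hl T hT, map_smul, smul_add, lA_smul]
  congr 1
  · rw [smul_comm]
  · split_ifs
    · rw [smul_comm]
    · rw [smul_zero]

theorem HL_zero (m : ℕ) (T : Finset (Fin N)) (s : Fin N) (hs : s ∈ T) (l : List (Fin N))
    (hl : ∀ i ∈ l, s ≤ i) : HL k N q m T l = 0 := by
  induction l with
  | nil => rfl
  | cons j l ih =>
    rw [HL, ih (fun i hi => hl i (List.mem_cons_of_mem _ hi)), map_zero, smul_zero, zero_add,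
      if_neg]
    intro h
    exact absurd (h s hs) (not_lt.2 (hl j List.mem_cons_self))

theorem IsH.zero (hh : IsH q h) (m : ℕ) (T : Finset (Fin N)) (hT : T.card = m) (s : Fin N)
    (hs : s ∈ T) (w : List (Fin N)) (hw : ∀ i ∈ w, s ≤ i) :
    h m (lA k N q m (wP k N q w) (eT k N q m T)) = 0 := by
  obtain ⟨l, hp, hl⟩ := exists_sorted w
  obtain ⟨c, hc⟩ := wP_perm (k := k) (q := q) hp
  rw [hc, lA_smul, map_smul, hh.word m _ hl T hT,
    HL_zero m T s hs l (fun i hi => hw i (hp.mem_iff.2 hi)), smul_zero]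

theorem kdk_word {m : ℕ} {T : Finset (Fin N)} (hT : T.card = m + 1) (l : List (Fin N)) :
    kdk k N q m (lA k N q (m + 1) (wP k N q l) (eT k N q (m + 1) T)) =
      ∑ i ∈ T, ((-1 : k) ^ (T.filter (fun s => s < i)).card) •
      ((∏ s ∈ T.filter (fun s => s ≤ i), q s i) •
          (lA k N q m (wP k N q (l ++ [i])) (eT k N q m (T.erase i)))
        + (- ∏ s ∈ T.filter (fun s => i ≤ s), q i s) •
          (rA k N q m (X k N q i) (lA k N q m (wP k N q l) (eT k N q m (T.erase i))))) := by
  rw [kdk_lA, kd_eT hT, map_sum]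
  refine Finset.sum_congr rfl fun i _ => ?_
  rw [map_smul, map_add, map_smul, map_smul, wP_append_singleton, lA_mul, rA_lA]

/-- differential on an inserted set -/
theorem kdk_insert (hq1 : ∀ i, q i i = 1) {m : ℕ} {T : Finset (Fin N)} (hT : T.card = m + 1)
    (j : Fin N) (hj : ∀ s ∈ T, j < s) (l : List (Fin N)) :
    kdk k N q (m + 1) (lA k N q (m + 2) (wP k N q l) (eT k N q (m + 2) (insert j T))) =
      lA k N q (m + 1) (wP k N q (l ++ [j])) (eT k N q (m + 1) T)
      + (- ∏ s ∈ T, q j s) • rA k N q (m + 1) (X k N q j) 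
          (lA k N q (m + 1) (wP k N q l) (eT k N q (m + 1) T))
      + (-1 : k) • ∑ i ∈ T, ((-1 : k) ^ (T.filter (fun s => s < i)).card) •
      ((q j i * ∏ s ∈ T.filter (fun s => s ≤ i), q s i) •
          (lA k N q (m + 1) (wP k N q (l ++ [i])) (eT k N q (m + 1) (insert j (T.erase i))))
        + (- ∏ s ∈ T.filter (fun s => i ≤ s), q i s) •
          (rA k N q (m + 1) (X k N q i) (lA k N q (m + 1) (wP k N q l)
            (eT k N q (m + 1) (insert j (T.erase i)))))) := by
  have hjT : j ∉ T := fun hjT => lt_irrefl _ (hj j hjT)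
  rw [kdk_word (by rw [Finset.card_insert_of_notMem hjT, hT]), Finset.sum_insert hjT,
    Finset.erase_insert hjT]
  congr 1
  · have f1 : (insert j T).filter (fun s => s < j) = ∅ := by
      ext s; simp; rintro (rfl | hs); exacts [le_rfl, (hj s hs).le]
    have f2 : (insert j T).filter (fun s => s ≤ j) = {j} := by
      ext s; simp; constructor
      · rintro ⟨rfl | hs, h2⟩; exacts [rfl, absurd (hj s hs) (not_lt.2 h2)]
      · rintro rfl; simp
    have f3 : (insert j T).filter (fun s => j ≤ s) = insert j T := by
      ext s; simp; rintro (rfl | hs); exacts [le_rfl, (hj s hs).le]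
    rw [f1, f2, f3, Finset.card_empty, pow_zero, one_smul, Finset.prod_singleton, hq1, one_smul,
      Finset.prod_insert hjT, hq1, one_mul]
  · rw [Finset.smul_sum]
    refine Finset.sum_congr rfl fun i hi => ?_
    have hji := hj i hi
    have f1 : (insert j T).filter (fun s => s < i) = insert j (T.filter (fun s => s < i)) := by
      rw [Finset.filter_insert, if_pos hji]
    have f2 : (insert j T).filter (fun s => s ≤ i) = insert j (T.filter (fun s => s ≤ i)) := by
      rw [Finset.filter_insert, if_pos hji.le]
    have f3 : (insert j T).filter (fun s => i ≤ s) = T.filter (fun s => i ≤ s) := by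
      rw [Finset.filter_insert, if_neg (not_le.2 hji)]
    rw [f1, f2, f3, Finset.card_insert_of_notMem (by simp [hjT]),
      Finset.prod_insert (by simp [hjT]), Finset.erase_insert_of_ne hji.ne, pow_succ, mul_comm,
      mul_smul]

/-- case 3 -/
theorem IsH.main3 (hq0 : ∀ i j, q i j ≠ 0) (hq1 : ∀ i, q i i = 1) (hh : IsH q h) (m : ℕ)
    (T : Finset (Fin N)) (hT : T.card = m + 1) (s₀ : Fin N) (hs₀ : s₀ ∈ T) (hmin : ∀ s ∈ T, s₀ ≤ s)
    (l : List (Fin N)) (hl : ∀ i ∈ l, s₀ ≤ i) :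
    kdk k N q (m + 1) (h (m + 1) (lA k N q (m + 1) (wP k N q l) (eT k N q (m + 1) T))) +
      h m (kdk k N q m (lA k N q (m + 1) (wP k N q l) (eT k N q (m + 1) T))) =
      lA k N q (m + 1) (wP k N q l) (eT k N q (m + 1) T) := by
  rw [hh.zero (m + 1) T hT s₀ hs₀ l hl, map_zero, zero_add, kdk_word hT, map_sum,
    Finset.sum_eq_single s₀]
  · have f1 : T.filter (fun s => s < s₀) = ∅ := by
      ext s; simp; exact hmin s
    have f2 : T.filter (fun s => s ≤ s₀) = {s₀} := by
      ext s; simp; constructor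
      · rintro ⟨hs, h2⟩; exact le_antisymm h2 (hmin s hs)
      · rintro rfl; simp [hs₀]
    have f3 : T.filter (fun s => s₀ ≤ s) = T := by
      ext s; simp; exact hmin s
    rw [f1, f2, f3, Finset.card_empty, pow_zero, one_smul, Finset.prod_singleton, hq1, one_smul]
    have hc : (T.erase s₀).card = m := by rw [Finset.card_erase_of_mem hs₀, hT]; rfl
    have hr := hh.rule m (T.erase s₀) hc s₀ l hl
    rw [if_pos (fun s hs => lt_of_le_of_ne (hmin s (Finset.mem_of_mem_erase hs))
      (Finset.ne_of_mem_erase hs).symm), Finset.insert_erase hs₀] at hr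
    have hX : wP k N q (l ++ [s₀]) = (chi q s₀ l)⁻¹ • wP k N q (s₀ :: l) := by
      rw [wP_cons, X_mul_wP, smul_smul, inv_mul_cancel₀ (chi_ne hq0 _ _), one_smul,
        wP_append_singleton]
    have hP : ∏ s ∈ T, q s₀ s = ∏ s ∈ T.erase s₀, q s₀ s := by
      rw [← Finset.mul_prod_erase T _ hs₀, hq1, one_mul]
    rw [hX, lA_smul, map_add, map_smul, map_smul, hr, hh.right, hP, smul_add, smul_smul, smul_smul,
      inv_mul_cancel₀ (chi_ne hq0 _ _), ← mul_assoc, inv_mul_cancel₀ (chi_ne hq0 _ _)]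
    module
  · intro i hi hne
    have hc : (T.erase i).card = m := by rw [Finset.card_erase_of_mem hi, hT]; rfl
    have hm : s₀ ∈ T.erase i := Finset.mem_erase.2 ⟨hne.symm, hs₀⟩
    rw [map_smul, map_add, map_smul, map_smul, hh.right, hh.zero m _ hc s₀ hm l hl,
      hh.zero m _ hc s₀ hm (l ++ [i]) (by
        intro t ht
        rcases List.mem_append.1 ht with ht | ht
        · exact hl t ht
        · rw [List.mem_singleton.1 ht]; exact hmin i hi)]
    simp
  · intro h; exact absurd hs₀ h

/-- case 2 -/
theorem IsH.main2 (hq1 : ∀ i, q i i = 1) (hh : IsH q h) (m : ℕ)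
    (T : Finset (Fin N)) (hT : T.card = m + 1) (j : Fin N) (hj : ∀ s ∈ T, j < s)
    (l : List (Fin N)) (hl : ∀ i ∈ l, j ≤ i)
    (ih : kdk k N q (m + 1) (h (m + 1) (lA k N q (m + 1) (wP k N q l) (eT k N q (m + 1) T))) +
      h m (kdk k N q m (lA k N q (m + 1) (wP k N q l) (eT k N q (m + 1) T))) =
      lA k N q (m + 1) (wP k N q l) (eT k N q (m + 1) T)) :
    kdk k N q (m + 1) (h (m + 1) (lA k N q (m + 1) (wP k N q (j :: l)) (eT k N q (m + 1) T))) +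
      h m (kdk k N q m (lA k N q (m + 1) (wP k N q (j :: l)) (eT k N q (m + 1) T))) =
      lA k N q (m + 1) (wP k N q (j :: l)) (eT k N q (m + 1) T) := by
  set z := lA k N q (m + 1) (wP k N q l) (eT k N q (m + 1) T) with hz
  set D := ∑ i ∈ T, ((-1 : k) ^ (T.filter (fun s => s < i)).card) •
      ((q j i * ∏ s ∈ T.filter (fun s => s ≤ i), q s i) •
          (lA k N q (m + 1) (wP k N q (l ++ [i])) (eT k N q (m + 1) (insert j (T.erase i))))
        + (- ∏ s ∈ T.filter (fun s => i ≤ s), q i s) •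
          (rA k N q (m + 1) (X k N q i) (lA k N q (m + 1) (wP k N q l)
            (eT k N q (m + 1) (insert j (T.erase i)))))) with hD
  set C : k := chi q j l * ∏ s ∈ T, q j s with hC
  have e1 : h m (kdk k N q m (lA k N q (m + 1) (wP k N q (j :: l)) (eT k N q (m + 1) T))) =
      C • rA k N q (m + 1) (X k N q j) (h m (kdk k N q m z)) + chi q j l • D := by
    rw [hz, kdk_word hT, kdk_word hT, map_sum, map_sum, map_sum, hD, Finset.smul_sum,
      Finset.smul_sum, ← Finset.sum_add_distrib]
    refine Finset.sum_congr rfl fun i hi => ?_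
    have hc : (T.erase i).card = m := by rw [Finset.card_erase_of_mem hi, hT]; rfl
    have hj' : ∀ s ∈ T.erase i, j < s := fun s hs => hj s (Finset.mem_of_mem_erase hs)
    have r1 := hh.rule m (T.erase i) hc j l hl
    have r2 := hh.rule m (T.erase i) hc j (l ++ [i]) (by
        intro t ht
        rcases List.mem_append.1 ht with ht | ht
        · exact hl t ht
        · rw [List.mem_singleton.1 ht]; exact (hj i hi).le)
    rw [if_pos hj'] at r1 r2
    have hP : ∏ s ∈ T, q j s = q j i * ∏ s ∈ T.erase i, q j s := by
      rw [← Finset.mul_prod_erase T _ hi]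
    have hcomm : ∀ y : KM k N q (m + 1), rA k N q (m + 1) (X k N q i) (rA k N q (m + 1) (X k N q j) y)
        = q j i • rA k N q (m + 1) (X k N q j) (rA k N q (m + 1) (X k N q i) y) := by
      intro y
      rw [← rA_mul, X_comm k N q j i, rA_smul, rA_mul]
    simp only [map_smul, map_add, hh.right, List.cons_append, r1, r2, hcomm, chi_append_singleton,
      hC, hP]
    module
  have e2 := hh.rule (m + 1) T hT j l hl
  rw [if_pos hj, ← hz, ← hC] at e2
  have e3 := kdk_insert hq1 hT j hj l
  rw [← hz, ← hD] at e3
  have e4 : lA k N q (m + 1) (wP k N q (j :: l)) (eT k N q (m + 1) T) =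
    chi q j l • lA k N q (m + 1) (wP k N q (l ++ [j])) (eT k N q (m + 1) T) := by
    rw [wP_cons, X_mul_wP, lA_smul, wP_append_singleton]
  rw [e1, e2, map_add, map_smul, map_smul, e3, kdk_rA, e4]
  have e5 : rA k N q (m + 1) (X k N q j) z = rA k N q (m + 1) (X k N q j) (kdk k N q (m + 1) (h (m + 1) z)) +
      rA k N q (m + 1) (X k N q j) (h m (kdk k N q m z)) := by
    rw [← map_add, ih]
  rw [e5, hC]
  module

theorem IsH.main (hq0 : ∀ i j, q i j ≠ 0) (hq1 : ∀ i, q i i = 1) (hh : IsH q h) (m : ℕ)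
    (z : KM k N q (m + 1)) : kdk k N q (m + 1) (h (m + 1) z) + h m (kdk k N q m z) = z := by
  induction z using KM_induct with
  | h0 => simp
  | hadd a b ha hb =>
    conv_rhs => rw [← ha, ← hb]
    simp only [map_add]; abel
  | hs c a ha => conv_rhs => rw [← ha]
                 simp only [map_smul, smul_add]
  | hr b z hz =>
    conv_rhs => rw [← hz]
    rw [kdk_rA, hh.right, hh.right, kdk_rA, map_add]
  | hw l hl T hT =>
    have hne : T.Nonempty := Finset.card_pos.1 (by omega)
    induction l with
    | nil => exact hh.main3 hq0 hq1 m T hT (T.min' hne) (T.min'_mem hne) (fun s hs => T.min'_le s hs) [] (by simp)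
    | cons j l ih =>
      rw [List.pairwise_cons] at hl
      by_cases hj : ∀ s ∈ T, j < s
      · exact hh.main2 hq1 m T hT j hj l hl.1 (ih hl.2)
      · push Not at hj
        obtain ⟨s, hs, hsj⟩ := hj
        have hmj := (T.min'_le s hs).trans hsj
        refine hh.main3 hq0 hq1 m T hT (T.min' hne) (T.min'_mem hne) (fun s hs => T.min'_le s hs) _ ?_
        intro i hi
        rcases List.mem_cons.1 hi with rfl | hi
        · exact hmj
        · exact hmj.trans (hl.1 i hi)

theorem IsH.base (hq1 : ∀ i, q i i = 1) (hh : IsH q h)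
    (a : QSA k N q) : kdk k N q 0 (h 0 (lA k N q 0 a (eT k N q 0 ∅))) + rA k N q 0 a (eT k N q 0 ∅) =
      lA k N q 0 a (eT k N q 0 ∅) := by
  induction a using A_induct with
  | h0 => rw [lA_zero, map_zero, map_zero, ← zero_smul k (0 : QSA k N q), rA_smul, zero_smul, zero_add]
  | hadd a b ha hb =>
    conv_rhs => rw [lA_add, ← ha, ← hb]
    simp only [map_add, lA_add, rA_add]; abel
  | hs c a ha => conv_rhs => rw [lA_smul, ← ha]
                 simp only [map_smul, smul_add, lA_smul, rA_smul]
  | hw l hl =>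
    induction l with
    | nil =>
      rw [hh.word 0 _ hl ∅ rfl, HL, map_zero, zero_add, wP_nil, rA_one, lA_one]
    | cons j l ih =>
      rw [List.pairwise_cons] at hl
      have hd : kdk k N q 0 (eT k N q 1 {j}) = lA k N q 0 (X k N q j) (eT k N q 0 ∅) +
          (-1 : k) • rA k N q 0 (X k N q j) (eT k N q 0 ∅) := by
        rw [kd_eT (by simp), Finset.sum_singleton]
        simp [hq1, Finset.filter_singleton]
      have e4 : lA k N q 0 (wP k N q (j :: l)) (eT k N q 0 ∅) =
          chi q j l • lA k N q 0 (wP k N q l) (lA k N q 0 (X k N q j) (eT k N q 0 ∅)) := by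
        rw [wP_cons, X_mul_wP, lA_smul, lA_mul]
      have e6 : rA k N q 0 (wP k N q (j :: l)) (eT k N q 0 ∅) =
          chi q j l • rA k N q 0 (X k N q j) (rA k N q 0 (wP k N q l) (eT k N q 0 ∅)) := by
        rw [wP_cons, X_mul_wP, rA_smul, rA_mul]
      have e5 := congrArg (rA k N q 0 (X k N q j)) (ih hl.2)
      rw [map_add] at e5
      rw [hh.rule 0 ∅ rfl j l hl.1, if_pos (by simp), insert_empty_eq, map_add, map_smul, map_smul,
        kdk_rA, kdk_lA, hd, e4, e6, map_add, map_smul, ← rA_lA, ← e5,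
        Finset.prod_empty]
      module

end Helpers3
section Helpers4
variable {k : Type} [Field k] {N : ℕ} {q : Fin N → Fin N → k}

variable (k N q) in
/-- elementary tensor -/
def tm {n : ℕ} (a : QSA k N q) (t : TP k N q n) : TP k N q (n + 1) :=
  show QSA k N q ⊗[k] TP k N q n from a ⊗ₜ[k] t

theorem TP_induct {n : ℕ} {p : TP k N q (n + 1) → Prop} (h0 : p 0)
    (hadd : ∀ a b, p a → p b → p (a + b)) (ht : ∀ a t, p (tm k N q a t)) (z) : p z := by
  have : ∀ z : QSA k N q ⊗[k] TP k N q n, p z := by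
    intro z
    induction z using TensorProduct.induction_on with
    | zero => exact h0
    | add x y hx hy => exact hadd x y hx hy
    | tmul a t => exact ht a t
  exact this z

theorem tm_add {n : ℕ} (a : QSA k N q) (t t' : TP k N q n) :
    tm k N q a (t + t') = tm k N q a t + tm k N q a t' := TensorProduct.tmul_add _ _ _

theorem tm_smul {n : ℕ} (c : k) (a : QSA k N q) (t : TP k N q n) :
    tm k N q a (c • t) = c • tm k N q a t := TensorProduct.tmul_smul _ _ _

variable (k N q) in
/-- an element of `A` seen in `TP 0` -/
def o0 (b : QSA k N q) : TP k N q 0 := b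

theorem exists_o0 (t : TP k N q 0) : ∃ b, t = o0 k N q b := ⟨t, rfl⟩

theorem rAct_zero (a b : QSA k N q) : rAct k N q 0 a (o0 k N q b) = o0 k N q (b * a) := rfl
theorem lAct_tm (n : ℕ) (a b : QSA k N q) (t : TP k N q n) :
    lAct k N q (n + 1) a (tm k N q b t) = tm k N q (a * b) t := rfl
theorem rAct_tm (n : ℕ) (a b : QSA k N q) (t : TP k N q n) :
    rAct k N q (n + 1) a (tm k N q b t) = tm k N q b (rAct k N q n a t) := rfl
theorem barMul_tm (n : ℕ) (a : QSA k N q) (t : TP k N q n) :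
    barMul₀ k N q n (tm k N q a t) = lAct k N q n a t := by
  cases n with
  | zero => rfl
  | succ n =>
    induction t using TP_induct with
    | h0 => rw [map_zero]; 
            have : tm k N q a (0 : TP k N q (n + 1)) = 0 := TensorProduct.tmul_zero _ _
            rw [this, map_zero]
    | hadd x y hx hy => rw [tm_add, map_add, hx, hy, map_add]
    | ht b t => rfl

theorem barFace_tm (n i : ℕ) (a : QSA k N q) (t : TP k N q (n + 1)) :
    barFace k N q (n + 1) (i + 1) (tm k N q a t) = tm k N q a (barFace k N q n i t) := by
  simp only [barFace]; rfl

theorem barD_tm (n : ℕ) (a : QSA k N q) (t : TP k N q (n + 1)) :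
    barD k N q (n + 1) (tm k N q a t) =
      lAct k N q (n + 1) a t + (-1 : k) • tm k N q a (barD k N q n t) := by
  have h1 : ∀ (n i : ℕ) (t : TP k N q (n + 1)), (((-1 : ℤ) ^ i) • barFace k N q n i) t =
      ((-1 : k) ^ i) • barFace k N q n i t := by
    intro n i t
    rw [LinearMap.smul_apply, ← Int.cast_smul_eq_zsmul k]; simp
  have hs : ∀ (s : Finset ℕ) (f : ℕ → TP k N q n), tm k N q a (∑ i ∈ s, f i) = ∑ i ∈ s, tm k N q a (f i) := 
    fun s f => TensorProduct.tmul_sum _ _ _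
  rw [barD, barD, Finset.sum_range_succ', LinearMap.add_apply, LinearMap.sum_apply, h1, pow_zero,
    one_smul, barFace, barMul_tm, LinearMap.sum_apply, hs, Finset.smul_sum]
  refine (add_comm _ _).trans ?_
  congr 1
  refine Finset.sum_congr rfl fun i _ => ?_
  rw [h1, h1, tm_smul, smul_smul, barFace_tm, pow_succ, mul_comm]

theorem barD_zero (a b : QSA k N q) : barD k N q 0 (tm k N q a (o0 k N q b)) = o0 k N q (a * b) := by
  have h : barD k N q 0 = barFace k N q 0 0 := by
    simp only [barD, zero_add, Finset.sum_range_one, pow_zero, one_smul]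
  rw [h]
  rfl

theorem outerAct_tmul (n : ℕ) (a : QSA k N q) (b) (t : TP k N q n) :
    outerAct k N q n (a ⊗ₜ[k] b) t = lAct k N q n a (rAct k N q n b.unop t) := by
  simp [outerAct]

variable (k N q) in
/-- `a ⊗ t ↦ a • f t` -/
def ext1 {n m : ℕ} (f : TP k N q n →ₗ[k] KM k N q m) : TP k N q (n + 1) →ₗ[k] KM k N q m :=
  show QSA k N q ⊗[k] TP k N q n →ₗ[k] KM k N q m from
  TensorProduct.lift (LinearMap.mk₂ k (fun a t => lA k N q m a (f t))
      (fun a a' b => by rw [lA_add])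
      (fun c a b => by rw [lA_smul])
      (fun a b b' => by rw [map_add, map_add])
      (fun c a b => by rw [map_smul, map_smul]))

theorem ext1_tm {n m : ℕ} (f : TP k N q n →ₗ[k] KM k N q m) (a t) :
    ext1 k N q f (tm k N q a t) = lA k N q m a (f t) := rfl

variable (k N q) in
/-- right mult on the generator -/
def f0 : TP k N q 0 →ₗ[k] KM k N q 0 :=
  show QSA k N q →ₗ[k] KM k N q 0 from
  { toFun := fun b => rA k N q 0 b (eT k N q 0 ∅)
    map_add' := fun a b => by rw [rA_add]
    map_smul' := fun c b => by rw [rA_smul]; rfl }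

theorem f0_apply (b : QSA k N q) : f0 k N q b = rA k N q 0 b (eT k N q 0 ∅) := rfl

/-- the map psi -/
def psiM (h : ∀ m, KM k N q m →ₗ[k] KM k N q (m + 1)) : (m : ℕ) → (TP k N q (m + 1) →ₗ[k] KM k N q m)
  | 0 => ext1 k N q (f0 k N q)
  | m + 1 => ext1 k N q ((h m).comp (psiM h m))

variable {h : ∀ m, KM k N q m →ₗ[k] KM k N q (m + 1)}

theorem psiM_zero (a : QSA k N q) (b : QSA k N q) :
    psiM h 0 (tm k N q a (o0 k N q b)) = lA k N q 0 a (rA k N q 0 b (eT k N q 0 ∅)) := rfl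

theorem psiM_succ (m) (a : QSA k N q) (t) :
    psiM h (m + 1) (tm k N q a t) = lA k N q (m + 1) a (h m (psiM h m t)) := rfl

theorem psiM_l (m) (a : QSA k N q) (t) :
    psiM h m (lAct k N q (m + 1) a t) = lA k N q m a (psiM h m t) := by
  induction t using TP_induct with
  | h0 => simp
  | hadd x y hx hy => simp only [map_add, hx, hy]
  | ht b t =>
    rw [lAct_tm]
    cases m with
    | zero =>
      obtain ⟨c', hc⟩ := exists_o0 t
      rw [hc]
      rw [psiM_zero, psiM_zero, lA_mul]
    | succ m => rw [psiM_succ, psiM_succ, lA_mul]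

theorem psiM_r (hh : IsH q h) (m) (a : QSA k N q) (t) :
    psiM h m (rAct k N q (m + 1) a t) = rA k N q m a (psiM h m t) := by
  induction m with
  | zero =>
    induction t using TP_induct with
    | h0 => simp
    | hadd x y hx hy => simp only [map_add, hx, hy]
    | ht b t => 
      obtain ⟨c', hc⟩ := exists_o0 t
      rw [hc]
      rw [rAct_tm, rAct_zero, psiM_zero, psiM_zero, rA_mul, rA_lA]
  | succ m ih => 
    induction t using TP_induct with
    | h0 => simp
    | hadd x y hx hy => simp only [map_add, hx, hy]
    | ht b t => 
      rw [rAct_tm, psiM_succ, psiM_succ, ih, hh.right, rA_lA]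

theorem psiM_equiv (hh : IsH q h) (m) (ab : QSAe k N q) (t) :
    psiM h m (outerAct k N q (m + 1) ab t) = ab • psiM h m t := by
  rw [← actE_eq]
  induction ab using TensorProduct.induction_on with
  | zero => rw [map_zero, LinearMap.zero_apply, map_zero, actE_zero]
  | add x y hx hy => rw [map_add, LinearMap.add_apply, map_add, hx, hy, actE_add]
  | tmul a b =>
    rw [outerAct_tmul, psiM_l, psiM_r hh, tmul_eq, actE_mul, ← rA_lA]; rfl

theorem psiM_chain (hq0 : ∀ i j, q i j ≠ 0) (hq1 : ∀ i, q i i = 1) (hh : IsH q h) (m) (t) :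
    psiM h m (barD k N q (m + 1) t) = kdk k N q m (psiM h (m + 1) t) := by
  induction m with
  | zero =>
    induction t using TP_induct with
    | h0 => simp
    | hadd x y hx hy => simp only [map_add, hx, hy]
    | ht a t =>
      rw [barD_tm, map_add, map_smul, psiM_l, psiM_succ, kdk_lA]
      induction t using TP_induct with
      | h0 => 
        have : tm k N q a (0 : TP k N q 0) = 0 := TensorProduct.tmul_zero _ _
        simp [this]
      | hadd x y hx hy =>
        simp only [map_add, ← hx, ← hy, tm_add, smul_add]; abel
      | ht b c => 
        obtain ⟨c', hc⟩ := exists_o0 c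
        rw [hc]
        have hb := hh.base hq1 b
        have hb2 := congrArg (fun z => lA k N q 0 a (rA k N q 0 c' z)) hb
        simp only [map_add] at hb2
        rw [barD_zero, psiM_zero, psiM_zero, ← rA_lA, hh.right, kdk_rA, rA_mul, ← hb2]
        module
  | succ m ih =>
    induction t using TP_induct with
    | h0 => simp
    | hadd x y hx hy => simp only [map_add, hx, hy]
    | ht a t =>
      rw [barD_tm, map_add, map_smul, psiM_l, psiM_succ, psiM_succ, kdk_lA, ih]
      have hb2 := congrArg (fun z => lA k N q (m + 1) a z) (hh.main hq0 hq1 m (psiM h (m + 1) t))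
      simp only [map_add] at hb2
      rw [← hb2]
      module

theorem psiM_tp (hh : IsH q h) (m : ℕ) (a : QSA k N q) (j : Fin m → Fin N) :
    psiM h m (tp k N q (m + 1) (Fin.cons a (Fin.snoc (fun t : Fin m => X k N q (j t)) 1))) =
      lA k N q m a (if StrictMono j then eT k N q m (Finset.univ.image j) else 0) := by
  induction m generalizing a with
  | zero =>
    have : tp k N q (0 + 1) (Fin.cons a (Fin.snoc (fun t : Fin 0 => X k N q (j t)) 1)) =
      tm k N q a (o0 k N q 1) := rfl
    rw [this, psiM_zero, rA_one, if_pos (show StrictMono j from fun x => x.elim0)]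
    simp
  | succ m ih =>
    have : tp k N q (m + 1 + 1) (Fin.cons a (Fin.snoc (fun t : Fin (m + 1) => X k N q (j t)) 1)) =
      tm k N q a (tp k N q (m + 1) (Fin.cons (X k N q (j 0))
        (Fin.snoc (fun t : Fin m => X k N q (j t.succ)) 1))) := by
      have e : (Fin.cons (X k N q (j 0)) (fun t : Fin m => X k N q (j t.succ)) : Fin (m + 1) → QSA k N q)
        = (fun t : Fin (m + 1) => X k N q (j t)) := by
        ext t; refine Fin.cases ?_ (fun t => ?_) t <;> simp
      rw [Fin.cons_snoc_eq_snoc_cons (X k N q (j 0)), e]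
      rfl
    rw [this, psiM_succ, ih (X k N q (j 0)) (fun t => j t.succ)]
    congr 1
    by_cases hs : StrictMono (fun t : Fin m => j t.succ)
    · have hinj := hs.injective
      have hr := hh.rule m (Finset.univ.image (fun t : Fin m => j t.succ))
        (by rw [Finset.card_image_of_injective _ hinj]; simp) (j 0) [] (by simp)
      have hz := hh.word m [] List.Pairwise.nil (Finset.univ.image (fun t : Fin m => j t.succ))
        (by rw [Finset.card_image_of_injective _ hinj]; simp)
      rw [hz, HL, map_zero, smul_zero, zero_add, wP_cons, wP_nil, mul_one] at hr
      rw [if_pos hs, hr]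
      have hiff : (∀ s ∈ Finset.univ.image (fun t : Fin m => j t.succ), j 0 < s) ↔ StrictMono j := by
        constructor
        · intro hlt x y hxy
          revert hxy
          refine Fin.cases ?_ (fun y => ?_) y
          · intro h; exact absurd h (Fin.not_lt_zero x)
          refine Fin.cases ?_ (fun x => ?_) x
          · intro _; exact hlt _ (by simp)
          · intro h; exact hs (Fin.succ_lt_succ_iff.1 h)
        · intro hm s hs
          simp only [Finset.mem_image, Finset.mem_univ, true_and] at hs
          obtain ⟨t, rfl⟩ := hs
          exact hm (Fin.succ_pos t)
      simp only [hiff]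
      have hset : insert (j 0) (Finset.univ.image (fun t : Fin m => j t.succ)) = Finset.univ.image j := by
        ext s; simp [Fin.exists_fin_succ, eq_comm]
      rw [hset, lA_one]; simp [chi]
    · rw [if_neg hs, map_zero, map_zero, if_neg]
      intro hm
      exact hs fun x y hxy => hm (Fin.succ_lt_succ_iff.2 hxy)

theorem jfun_strictMono (m : ℕ) (S) : StrictMono (jfun N m S) := fun x y hxy => by
  simpa [jfun] using hxy

theorem jfun_image (m : ℕ) (S) : Finset.univ.image (jfun N m S) = S.1 := by
  apply Finset.eq_of_subset_of_card_le
  · intro s hs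
    simp only [Finset.mem_image, Finset.mem_univ, true_and] at hs
    obtain ⟨t, rfl⟩ := hs
    exact (S.1.orderIsoOfFin S.2 t).2
  · rw [Finset.card_image_of_injective _ (jfun_strictMono m S).injective]; simp [S.2]

theorem Qs_one (hq0 : ∀ i j, q i j ≠ 0) (hq1 : ∀ i, q i i = 1)
    (hqinv : ∀ i j, q j i = (q i j)⁻¹)
    (Qs : (m : ℕ) → (Fin m → Fin N) → Equiv.Perm (Fin m) → k)
    (hQs : ∀ (m : ℕ) (j : Fin m → Fin N), Function.Injective j →
      ∀ π : Equiv.Perm (Fin m),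
        Qs m j π • xprod k N q m (fun t => j (π t)) = xprod k N q m j) (m : ℕ)
    (j : Fin m → Fin N) (hj : StrictMono j) : Qs m j 1 = 1 := by
  obtain ⟨nf, hnf⟩ := exists_nf hq0 hq1 hqinv
  have h1 := hQs m j hj.injective 1
  have hx : xprod k N q m j = wP k N q (List.ofFn j) := by
    simp [xprod, wP, List.map_ofFn, Function.comp_def]
  simp only [Equiv.Perm.one_apply] at h1
  rw [hx] at h1
  have h2 := congrArg nf h1
  rw [map_smul, hnf _ (List.pairwise_ofFn.2 fun a b hab => (hj hab).le)] at h2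
  have h3 := DFunLike.congr_fun h2 (List.ofFn j : Multiset (Fin N))
  simpa using h3

theorem psiM_phi (hq0 : ∀ i j, q i j ≠ 0) (hq1 : ∀ i, q i i = 1)
    (hqinv : ∀ i j, q j i = (q i j)⁻¹)
    (Qs : (m : ℕ) → (Fin m → Fin N) → Equiv.Perm (Fin m) → k)
    (hQs : ∀ (m : ℕ) (j : Fin m → Fin N), Function.Injective j →
      ∀ π : Equiv.Perm (Fin m),
        Qs m j π • xprod k N q m (fun t => j (π t)) = xprod k N q m j) (hh : IsH q h) (m : ℕ) :
    (psiM h m).comp (phi k N q Qs m) = LinearMap.id := by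
  refine Finsupp.lhom_ext fun S w => ?_
  rw [LinearMap.comp_apply, LinearMap.id_apply]
  have e1 : phi k N q Qs m (Finsupp.single S w) = outerAct k N q (m + 1) w (phiElt k N q Qs m S) := by
    simp [phi]
  have e2 : psiM h m (phiElt k N q Qs m S) = eT k N q m S.1 := by
    rw [phiElt, map_sum, Finset.sum_eq_single 1]
    · have e := psiM_tp hh m 1 (jfun N m S)
      rw [if_pos (jfun_strictMono m S), jfun_image, lA_one] at e
      rw [map_smul]
      simp only [Equiv.Perm.one_apply]
      rw [e, Qs_one hq0 hq1 hqinv Qs hQs m _ (jfun_strictMono m S)]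
      simp
    · intro π _ hπ
      rw [map_smul, psiM_tp hh m 1 (fun t => jfun N m S (π t)), if_neg, map_zero, smul_zero]
      intro hm
      apply hπ
      have hmono : StrictMono π := fun x y hxy => (jfun_strictMono m S).lt_iff_lt.1 (hm hxy)
      have : hmono.orderIsoOfSurjective π π.surjective = OrderIso.refl _ := Subsingleton.elim _ _
      ext t
      have h2 := congrArg (fun e : Fin m ≃o Fin m => e t) this
      simpa using congrArg Fin.val h2
    · simp
  rw [e1, psiM_equiv hh, e2, ← actE_eq, eT_pos S.2, actE_single, mul_one]

theorem phi_psiM (hq0 : ∀ i j, q i j ≠ 0) (hq1 : ∀ i, q i i = 1)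
    (hqinv : ∀ i j, q j i = (q i j)⁻¹)
    (Qs : (m : ℕ) → (Fin m → Fin N) → Equiv.Perm (Fin m) → k)
    (hQs : ∀ (m : ℕ) (j : Fin m → Fin N), Function.Injective j →
      ∀ π : Equiv.Perm (Fin m),
        Qs m j π • xprod k N q m (fun t => j (π t)) = xprod k N q m j) :
    (phi k N q Qs 0).comp (psiM h 0) = LinearMap.id := by
  ext t
  rw [LinearMap.comp_apply, LinearMap.id_apply]
  induction t using TP_induct with
  | h0 => simp
  | hadd x y hx hy => rw [map_add, map_add, hx, hy]
  | ht a b =>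
    obtain ⟨b', hc⟩ := exists_o0 b
    rw [hc]
    rw [psiM_zero, eT_pos (m := 0) (T := ∅) rfl, lA, rA, actE_single, actE_single, mul_one]
    have e1 (S w) : phi k N q Qs 0 (Finsupp.single S w) = outerAct k N q (0 + 1) w (phiElt k N q Qs 0 S) := by
      simp [phi]
    have e2 (S) : phiElt k N q Qs 0 S = tm k N q 1 (o0 k N q 1) := by
      rw [phiElt, Fintype.sum_unique]
      rw [show (default : Equiv.Perm (Fin 0)) = 1 from rfl,
        Qs_one hq0 hq1 hqinv Qs hQs 0 _ (jfun_strictMono 0 S)]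
      simp only [Equiv.Perm.sign_one, Units.val_one, one_smul]
      rfl
    have e3 : lE a * rE b' = a ⊗ₜ[k] MulOpposite.op b' := by
      rw [tmul_eq, rE_lE]; rfl
    rw [e1, e2, e3, outerAct_tmul, rAct_tm, lAct_tm, rAct_zero, mul_one, one_mul]
    rfl

end Helpers4
/-- Remark 2.4 of the paper: there is a family of `A^e`-module homomorphisms
`ψ_m : A^{⊗(m+2)} → A^e ⊗ ∧^m(V)` forming a chain map from the bar resolution to the
Koszul complex, with `ψ_0 = id` (under the canonical identification `φ_0` of
`A^e ⊗ ∧^0(V)` with `A ⊗ A`) and `ψ_m ∘ φ_m = id` for all `m`.  `A^e`-linearity is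
expressed through equivariance for the outer `A^e`-action on `A^{⊗(m+2)}`. -/
theorem stmt7 (k : Type) [Field k] [CharZero k] (N : ℕ) (hN : 0 < N)
    (q : Fin N → Fin N → k) (hq0 : ∀ i j, q i j ≠ 0) (hq1 : ∀ i, q i i = 1)
    (hqinv : ∀ i j, q j i = (q i j)⁻¹)
    (Qs : (m : ℕ) → (Fin m → Fin N) → Equiv.Perm (Fin m) → k)
    -- `Qs m j π` is the scalar `q_π^{j_1,…,j_m}`, characterised by the equation
    -- `q_π^{j_1,…,j_m} • x_{j_{π(1)}} ⋯ x_{j_{π(m)}} = x_{j_1} ⋯ x_{j_m}` in `S_q(V)`: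
    (hQs : ∀ (m : ℕ) (j : Fin m → Fin N), Function.Injective j →
      ∀ π : Equiv.Perm (Fin m),
        Qs m j π • xprod k N q m (fun t => j (π t)) = xprod k N q m j)
 :
    ∃ psi : (m : ℕ) → (TP k N q (m + 1) →ₗ[k] KM k N q m),
      -- each `ψ_m` is a homomorphism of `A^e`-modules:
      (∀ (m : ℕ) (ab : QSAe k N q) (t : TP k N q (m + 1)),
        psi m (outerAct k N q (m + 1) ab t) = ab • psi m t) ∧
      -- `ψ_0 = id` on `A^e = A ⊗ A`:
      ((psi 0).comp (phi k N q Qs 0) = LinearMap.id ∧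
        (phi k N q Qs 0).comp (psi 0) = LinearMap.id) ∧
      -- `ψ` is a chain map from the bar resolution to the Koszul complex:
      (∀ m : ℕ, (psi m).comp (barD k N q (m + 1)) = (kdk k N q m).comp (psi (m + 1))) ∧
      -- `ψ_m ∘ φ_m = id` for all `m`:
      (∀ m : ℕ, (psi m).comp (phi k N q Qs m) = LinearMap.id) := by
  choose h hr hw using fun m => exists_h (k := k) hq0 hq1 hqinv m
  have hh : IsH q h := ⟨hr, hw⟩
  refine ⟨psiM h, fun m ab t => psiM_equiv hh m ab t,
    ⟨psiM_phi hq0 hq1 hqinv Qs hQs hh 0, phi_psiM hq0 hq1 hqinv Qs hQs⟩, fun m => ?_,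
    fun m => psiM_phi hq0 hq1 hqinv Qs hQs hh m⟩
  exact LinearMap.ext fun t => psiM_chain hq0 hq1 hh m t
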